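/- Let α ∈ ℤ^n, let 1 ≤ i ≤ n−1, and let α° denote α with its i-th and (i+1)-th entries negated. Assume each ASEP polynomial f_κ (κ ∈ ℕ^n) is divisible by ∏_{j:κ_j>0} x_j, so that the extended ASEP polynomial f_α is a polynomial. Then: (1) if α_i > α_{i+1} ≥ 0 or −α_i > −α_{i+1} > 0, then T_i f_α = f_{s_i·α}; if α_i = α_{i+1}, then T_i f_α = t f_α; if α_{i+1} > α_i ≥ 0 or −α_{i+1} > −α_i > 0, then T_i f_α = t f_{s_i·α} − (1−t) f_α. (2) If α_i > −α_{i+1} > 0, then T_i f_α = f_{s_i·α} + (1−t) f_{α°}; if α_i = −α_{i+1} > 0, then T_i f_α = f_{s_i·α}; if −α_{i+1} > α_i ≥ 0, then T_i f_α = t f_{s_i·α}. (3) If −α_i > α_{i+1} ≥ 0, then T_i f_α = f_{s_i·α} − (1−t) f_α; if −α_i = α_{i+1} > 0, then T_i f_α = t f_{s_i·α} − (1−t) f_α; if α_{i+1} > −α_i > 0, then T_i f_α = t f_{s_i·α} − (1−t)(f_α + f_{α°}). -/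

import Mathlib

open MvPolynomial

noncomputable section
open scoped Classical

/-- The field `K = ℚ(q,t)`. -/
abbrev K : Type := FractionRing (MvPolynomial (Fin 2) ℚ)

/-- The indeterminate `q` as an element of `K`. -/
def qq : K := algebraMap (MvPolynomial (Fin 2) ℚ) K (X 0)

/-- The indeterminate `t` as an element of `K`. -/
def tt : K := algebraMap (MvPolynomial (Fin 2) ℚ) K (X 1)

/-- The size `|ν|` of a composition. -/
def csize {n : ℕ} (ν : Fin n → ℕ) : ℕ := ∑ i, ν i

/-- `k_i(ν) = #{j < i : ν_j > ν_i} + #{j > i : ν_j ≥ ν_i}`. -/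
def kstat {n : ℕ} (ν : Fin n → ℕ) (i : Fin n) : ℕ :=
  Set.ncard {j : Fin n | j < i ∧ ν i < ν j} + Set.ncard {j : Fin n | i < j ∧ ν i ≤ ν j}

/-- The evaluation point `ν̃ = (q^{ν_i} t^{-k_i(ν)})_i`. -/
def evalPt {n : ℕ} (ν : Fin n → ℕ) : Fin n → K :=
  fun i => qq ^ ν i * tt ^ (-(kstat ν i : ℤ))

/-- Weakly decreasing composition. -/
def IsPartition {n : ℕ} (l : Fin n → ℕ) : Prop := ∀ i j : Fin n, i ≤ j → l j ≤ l i

/-- The action `σ·μ := μ ∘ σ⁻¹`. -/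
def permAct {n : ℕ} (σ : Equiv.Perm (Fin n)) (μ : Fin n → ℕ) : Fin n → ℕ := μ ∘ ⇑σ.symm

/-- `S_n(λ)`: the rearrangements of `λ`. -/
def Sn {n : ℕ} (l : Fin n → ℕ) : Set (Fin n → ℕ) :=
  {μ | ∃ σ : Equiv.Perm (Fin n), permAct σ l = μ}

/-- The rearrangements of `λ` as a `Finset`. -/
def SnFinset {n : ℕ} (l : Fin n → ℕ) : Finset (Fin n → ℕ) :=
  Finset.image (fun σ : Equiv.Perm (Fin n) => permAct σ l) Finset.univ

/-- The exponent `Finsupp` of the monomial `x^μ`. -/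
def expOf {n : ℕ} (μ : Fin n → ℕ) : Fin n →₀ ℕ := Finsupp.equivFunOnFinite.symm μ

/-- Characterization of the interpolation nonsymmetric Macdonald polynomial `E*_μ`. -/
def IsEstar {n : ℕ} (μ : Fin n → ℕ) (f : MvPolynomial (Fin n) K) : Prop :=
  f.totalDegree ≤ csize μ ∧ coeff (expOf μ) f = 1 ∧
    ∀ ν : Fin n → ℕ, csize ν ≤ csize μ → ν ≠ μ → eval (evalPt ν) f = 0

/-- The interpolation nonsymmetric Macdonald polynomial `E*_μ` (unique by Knop–Sahi). -/
def Estar {n : ℕ} (μ : Fin n → ℕ) : MvPolynomial (Fin n) K :=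
  if h : ∃ f, IsEstar μ f then h.choose else 0

/-- Characterization of the interpolation (symmetric) Macdonald polynomial `P*_λ`. -/
def IsPstar {n : ℕ} (l : Fin n → ℕ) (f : MvPolynomial (Fin n) K) : Prop :=
  f.IsSymmetric ∧ f.totalDegree ≤ csize l ∧ coeff (expOf l) f = 1 ∧
    ∀ ν : Fin n → ℕ, IsPartition ν → csize ν ≤ csize l → ν ≠ l → eval (evalPt ν) f = 0

/-- The interpolation Macdonald polynomial `P*_λ`. -/
def Pstar {n : ℕ} (l : Fin n → ℕ) : MvPolynomial (Fin n) K :=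
  if h : ∃ f, IsPstar l f then h.choose else 0

/-- The space `V*_λ`. -/
def Vstar {n : ℕ} (l : Fin n → ℕ) : Submodule K (MvPolynomial (Fin n) K) :=
  (restrictTotalDegree (Fin n) K (csize l)) ⊓
    ⨅ (ν : Fin n → ℕ) (_ : csize ν ≤ csize l ∧ ν ∉ Sn l),
      LinearMap.ker (aeval (R := K) (evalPt ν)).toLinearMap

/-- Exchange of the variables `x_i` and `x_j` in a polynomial. -/
def swapVars {n : ℕ} (i j : Fin n) (f : MvPolynomial (Fin n) K) : MvPolynomial (Fin n) K :=
  rename (Equiv.swap i j) f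

/-- Exact division of polynomials: the unique `g` with `a = b * g` when it exists. -/
def exactDiv {n : ℕ} (a b : MvPolynomial (Fin n) K) : MvPolynomial (Fin n) K :=
  if h : ∃ g, a = b * g then h.choose else 0

/-- The Hecke operator
`T f = t f − ((t x_i − x_j)/(x_i − x_j))·(f − s_i f)` (where `j = i+1`). -/
def hecke {n : ℕ} (i j : Fin n) (f : MvPolynomial (Fin n) K) : MvPolynomial (Fin n) K :=
  C tt * f - (C tt * X i - X j) * exactDiv (f - swapVars i j f) (X i - X j)

/-- The Coxeter length of a permutation (number of inversions). -/
def permLength {n : ℕ} (σ : Equiv.Perm (Fin n)) : ℕ :=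
  Set.ncard {p : Fin n × Fin n | p.1 < p.2 ∧ σ p.2 < σ p.1}

/-- The adjacent transposition `s_i = (i, i+1)` (0-indexed). -/
def adjSwap {n : ℕ} (i : {i : ℕ // i + 1 < n}) : Equiv.Perm (Fin n) :=
  Equiv.swap ⟨i.1, Nat.lt_of_succ_lt i.2⟩ ⟨i.1 + 1, i.2⟩

/-- The Hecke operator `T_i` for an adjacent transposition index. -/
def heckeAt {n : ℕ} (i : {i : ℕ // i + 1 < n}) :
    MvPolynomial (Fin n) K → MvPolynomial (Fin n) K :=
  hecke ⟨i.1, Nat.lt_of_succ_lt i.2⟩ ⟨i.1 + 1, i.2⟩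

/-- `T_{i_1} ⋯ T_{i_ℓ} f` for a word `w = [i_1, …, i_ℓ]`. -/
def Tword {n : ℕ} (w : List {i : ℕ // i + 1 < n}) (f : MvPolynomial (Fin n) K) :
    MvPolynomial (Fin n) K :=
  w.foldr heckeAt f

/-- `w` is a reduced word for `σ`. -/
def IsReducedWordOf {n : ℕ} (w : List {i : ℕ // i + 1 < n}) (σ : Equiv.Perm (Fin n)) : Prop :=
  (w.map adjSwap).prod = σ ∧ w.length = permLength σ

/-- `T_σ`, computed from a reduced word of `σ` (independent of the choice, by the
Hecke algebra relations). -/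
def Tsigma {n : ℕ} (σ : Equiv.Perm (Fin n)) :
    MvPolynomial (Fin n) K → MvPolynomial (Fin n) K :=
  if h : ∃ w, IsReducedWordOf w σ then Tword h.choose else id

/-- `σ_μ`: the (unique) shortest permutation with `σ·l = μ`. -/
def sigmaMin {n : ℕ} (l μ : Fin n → ℕ) : Equiv.Perm (Fin n) :=
  if h : ∃ σ, permAct σ l = μ ∧ ∀ τ, permAct τ l = μ → permLength σ ≤ permLength τ then
    h.choose else 1

/-- The weakly decreasing rearrangement of a composition. -/
def sortDesc {n : ℕ} (μ : Fin n → ℕ) : Fin n → ℕ :=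
  if h : ∃ l, IsPartition l ∧ μ ∈ Sn l then h.choose else μ

/-- The interpolation ASEP polynomial `f*_μ = T_{σ_μ} E*_λ`, where `λ` is the weakly
decreasing rearrangement of `μ`. -/
def fstar {n : ℕ} (μ : Fin n → ℕ) : MvPolynomial (Fin n) K :=
  Tsigma (sigmaMin (sortDesc μ) μ) (Estar (sortDesc μ))

/-- The composition with entries `i` and `j` exchanged. -/
def swapEntries {n : ℕ} (i j : Fin n) (μ : Fin n → ℕ) : Fin n → ℕ := μ ∘ ⇑(Equiv.swap i j)
/-- The (homogeneous) ASEP polynomial `f_κ`: the top homogeneous component of `f*_κ`. -/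
def fhom {n : ℕ} (κ : Fin n → ℕ) : MvPolynomial (Fin n) K :=
  homogeneousComponent (csize κ) (fstar κ)

/-- `‖α‖ = (|α_1|, …, |α_n|)`. -/
def absComp {n : ℕ} (α : Fin n → ℤ) : Fin n → ℕ := fun i => (α i).natAbs

/-- The extended ASEP polynomial `f_α = f_{‖α‖} / ∏_{j : α_j < 0} (−t^{n−1} x_j)`. -/
def fext {n : ℕ} (α : Fin n → ℤ) : MvPolynomial (Fin n) K :=
  exactDiv (fhom (absComp α))
    (∏ j ∈ Finset.univ.filter (fun j : Fin n => α j < 0), (C (-(tt ^ (n - 1))) * X j))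

/-- `s_i·α`: entries `i` and `j` exchanged. -/
def swapEntriesZ {n : ℕ} (i j : Fin n) (α : Fin n → ℤ) : Fin n → ℤ := α ∘ ⇑(Equiv.swap i j)

/-- `α°`: entries `i` and `j` negated. -/
def negPairZ {n : ℕ} (i j : Fin n) (α : Fin n → ℤ) : Fin n → ℤ :=
  fun m => if m = i ∨ m = j then -α m else α m

/-! ### Basic facts on the Hecke operator -/

lemma tt_ne_zero : tt ≠ 0 := by
  unfold tt
  rw [Ne, FaithfulSMul.algebraMap_eq_zero_iff]
  exact X_ne_zero _

lemma qq_ne_zero : qq ≠ 0 := by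
  unfold qq
  rw [Ne, FaithfulSMul.algebraMap_eq_zero_iff]
  exact X_ne_zero _

lemma qt_inj_nat (a b k l : ℕ) (h : qq ^ a * tt ^ k = qq ^ b * tt ^ l) : a = b := by
  unfold qq tt at h
  rw [← map_pow, ← map_pow, ← map_pow, ← map_pow, ← map_mul, ← map_mul] at h
  have h' := IsFractionRing.injective (MvPolynomial (Fin 2) ℚ) K h
  have h2 := congrArg (eval (![2, 1] : Fin 2 → ℚ)) h'
  simp at h2
  exact h2

lemma tt_ne_one : tt ≠ 1 := by
  intro h
  unfold tt at h
  rw [← map_one (algebraMap (MvPolynomial (Fin 2) ℚ) K)] at h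
  have h' := IsFractionRing.injective (MvPolynomial (Fin 2) ℚ) K h
  have h2 := congrArg (eval (![2, 2] : Fin 2 → ℚ)) h'
  norm_num at h2

lemma qt_inj (a b k l : ℕ) (h : qq ^ a * tt ^ (-(k : ℤ)) = qq ^ b * tt ^ (-(l : ℤ))) : a = b := by
  apply qt_inj_nat a b l k
  have ht := tt_ne_zero
  rw [zpow_neg, zpow_neg, zpow_natCast, zpow_natCast] at h
  field_simp at h
  linear_combination h

lemma dvd_sub_swapVars {n : ℕ} (i j : Fin n) (f : MvPolynomial (Fin n) K) :
    (X i - X j : MvPolynomial (Fin n) K) ∣ f - swapVars i j f := by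
  unfold swapVars
  induction f using MvPolynomial.induction_on with
  | C a => simp
  | add p q hp hq =>
    rw [map_add]
    have := dvd_add hp hq
    convert this using 1
    ring
  | mul_X p k hp =>
    rw [map_mul, rename_X]
    have h2 : (X i - X j : MvPolynomial (Fin n) K) ∣ X k - X (Equiv.swap i j k) := by
      rw [Equiv.swap_apply_def]
      split_ifs with h1 h2
      · rw [h1]
      · rw [h2, ← neg_dvd, neg_sub]
      · simp
    have := dvd_add (Dvd.dvd.mul_right hp (X k)) (Dvd.dvd.mul_left h2 (rename (Equiv.swap i j) p))
    convert this using 1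
    ring

lemma exactDiv_spec {n : ℕ} {a b : MvPolynomial (Fin n) K} (h : b ∣ a) :
    a = b * exactDiv a b := by
  have h' : ∃ g, a = b * g := h
  unfold exactDiv
  rw [dif_pos h']
  exact h'.choose_spec

lemma X_sub_ne {n : ℕ} {i j : Fin n} (h : i ≠ j) :
    (X i - X j : MvPolynomial (Fin n) K) ≠ 0 := by
  intro h'
  exact h (X_injective (sub_eq_zero.mp h'))

lemma hecke_spec {n : ℕ} (i j : Fin n) (f : MvPolynomial (Fin n) K) :
    (X i - X j) * hecke i j f =
      (1 - C tt) * X j * f + (C tt * X i - X j) * swapVars i j f := by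
  have h := exactDiv_spec (dvd_sub_swapVars i j f)
  unfold hecke
  linear_combination (C tt * X i - X j) * h

lemma hecke_eq {n : ℕ} {i j : Fin n} (hij : i ≠ j) {f g : MvPolynomial (Fin n) K}
    (h : (X i - X j) * g = (1 - C tt) * X j * f + (C tt * X i - X j) * swapVars i j f) :
    hecke i j f = g := by
  apply mul_left_cancel₀ (X_sub_ne hij)
  rw [hecke_spec, h]

lemma ne_of_adj {n : ℕ} {i j : Fin n} (hij : (j : ℕ) = (i : ℕ) + 1) : i ≠ j := by
  intro h; subst h; omega

lemma swapVars_mul {n : ℕ} (i j : Fin n) (f g : MvPolynomial (Fin n) K) :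
    swapVars i j (f * g) = swapVars i j f * swapVars i j g := map_mul _ _ _
lemma swapVars_add {n : ℕ} (i j : Fin n) (f g : MvPolynomial (Fin n) K) :
    swapVars i j (f + g) = swapVars i j f + swapVars i j g := map_add _ _ _
lemma swapVars_sub {n : ℕ} (i j : Fin n) (f g : MvPolynomial (Fin n) K) :
    swapVars i j (f - g) = swapVars i j f - swapVars i j g := map_sub _ _ _
lemma swapVars_C {n : ℕ} (i j : Fin n) (a : K) :
    swapVars i j (C a) = C a := rename_C _ _
lemma swapVars_one {n : ℕ} (i j : Fin n) :
    swapVars i j 1 = 1 := map_one _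
lemma swapVars_X {n : ℕ} (i j k : Fin n) :
    swapVars i j (X k) = X (Equiv.swap i j k) := rename_X _ _
lemma swapVars_swapVars {n : ℕ} (i j : Fin n) (f : MvPolynomial (Fin n) K) :
    swapVars i j (swapVars i j f) = f := by
  unfold swapVars
  rw [rename_rename]
  have : (⇑(Equiv.swap i j) ∘ ⇑(Equiv.swap i j)) = id := by
    funext x; simp
  rw [this, rename_id_apply]

lemma swapVars_hecke {n : ℕ} (k l i j : Fin n) (f : MvPolynomial (Fin n) K) :
    (X (Equiv.swap k l i) - X (Equiv.swap k l j)) * swapVars k l (hecke i j f) =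
      (1 - C tt) * X (Equiv.swap k l j) * swapVars k l f +
      (C tt * X (Equiv.swap k l i) - X (Equiv.swap k l j)) * swapVars k l (swapVars i j f) := by
  have := congrArg (swapVars k l) (hecke_spec i j f)
  simpa only [swapVars_mul, swapVars_add, swapVars_sub, swapVars_C, swapVars_X, swapVars_one]
    using this

lemma hecke_smul {n : ℕ} {i j : Fin n} (hij : i ≠ j) (c : K) (f : MvPolynomial (Fin n) K) :
    hecke i j (C c * f) = C c * hecke i j f := by
  apply hecke_eq hij
  rw [swapVars_mul, swapVars_C]
  linear_combination C c * hecke_spec i j f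

lemma hecke_quad {n : ℕ} {i j : Fin n} (hij : i ≠ j) (f : MvPolynomial (Fin n) K) :
    hecke i j (hecke i j f) = C tt * f - C (1 - tt) * hecke i j f := by
  apply hecke_eq hij
  have h1 := hecke_spec i j f
  have h2 := swapVars_hecke i j i j f
  rw [swapVars_swapVars, Equiv.swap_apply_left, Equiv.swap_apply_right] at h2
  apply mul_left_cancel₀ (X_sub_ne hij)
  rw [map_sub, map_one]
  linear_combination
    (-(1 - C tt) * (X i - X j) - (1 - C tt) * X j) * h1 + (C tt * X i - X j) * h2

lemma swap_braid {n : ℕ} {i j k : Fin n} (hij : i ≠ j) (hjk : j ≠ k) (hik : i ≠ k) (x : Fin n) :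
    Equiv.swap i j (Equiv.swap j k (Equiv.swap i j x)) =
      Equiv.swap j k (Equiv.swap i j (Equiv.swap j k x)) := by
  have s1k : Equiv.swap i j k = k := Equiv.swap_apply_of_ne_of_ne hik.symm hjk.symm
  have s2i : Equiv.swap j k i = i := Equiv.swap_apply_of_ne_of_ne hij hik
  by_cases h1 : x = i
  · subst h1; simp [s1k, s2i]
  by_cases h2 : x = j
  · subst h2; simp [s1k, s2i]
  by_cases h3 : x = k
  · subst h3; simp [s1k, s2i]
  rw [Equiv.swap_apply_of_ne_of_ne h1 h2, Equiv.swap_apply_of_ne_of_ne h2 h3,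
    Equiv.swap_apply_of_ne_of_ne h1 h2, Equiv.swap_apply_of_ne_of_ne h2 h3]

lemma swap_comm' {n : ℕ} {i j k l : Fin n}
    (hik : i ≠ k) (hil : i ≠ l) (hjk : j ≠ k) (hjl : j ≠ l) (x : Fin n) :
    Equiv.swap i j (Equiv.swap k l x) = Equiv.swap k l (Equiv.swap i j x) := by
  simp only [Equiv.swap_apply_def]
  grind

lemma hecke_comm {n : ℕ} {i j k l : Fin n} (hij : i ≠ j) (hkl : k ≠ l)
    (hik : i ≠ k) (hil : i ≠ l) (hjk : j ≠ k) (hjl : j ≠ l) (f : MvPolynomial (Fin n) K) :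
    hecke i j (hecke k l f) = hecke k l (hecke i j f) := by
  apply mul_left_cancel₀ (X_sub_ne hij)
  apply mul_left_cancel₀ (X_sub_ne hkl)
  have h1 := hecke_spec i j (hecke k l f)
  have h2 := hecke_spec k l (hecke i j f)
  have h3 := swapVars_hecke i j k l f
  have h4 := swapVars_hecke k l i j f
  rw [Equiv.swap_apply_of_ne_of_ne hik.symm hjk.symm,
    Equiv.swap_apply_of_ne_of_ne hil.symm hjl.symm] at h3
  rw [Equiv.swap_apply_of_ne_of_ne hik hil,
    Equiv.swap_apply_of_ne_of_ne hjk hjl] at h4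
  have h5 : swapVars i j (swapVars k l f) = swapVars k l (swapVars i j f) := by
    unfold swapVars
    rw [rename_rename, rename_rename]
    congr 2
    funext x
    exact swap_comm' hik hil hjk hjl x
  rw [h5] at h3
  have h6 := hecke_spec i j f
  have h7 := hecke_spec k l f
  linear_combination (X k - X l) * h1 - (X i - X j) * h2 + (C tt * X i - X j) * h3
    - (C tt * X k - X l) * h4 + (1 - C tt) * X j * h7 - (1 - C tt) * X l * h6

lemma braid_field {L : Type*} [Field L] (x y z t f f1 f2 f12 f21 f121 g h u s1h s1g s2g s12g
    g' h' u' s2h' s2g' s1g' s21g' : L) (hxy : x - y ≠ 0) (hyx : y - x ≠ 0) (hyz : y - z ≠ 0)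
    (hzy : z - y ≠ 0) (hxz : x - z ≠ 0)
    (e1 : (x - y) * u = (1 - t) * y * h + (t * x - y) * s1h)
    (e2 : (y - z) * h = (1 - t) * z * g + (t * y - z) * s2g)
    (e3 : (x - z) * s1h = (1 - t) * z * s1g + (t * x - z) * s12g)
    (e4 : (x - y) * g = (1 - t) * y * f + (t * x - y) * f1)
    (e5 : (y - x) * s1g = (1 - t) * x * f1 + (t * y - x) * f)
    (e6 : (x - z) * s2g = (1 - t) * z * f2 + (t * x - z) * f21)
    (e7 : (y - z) * s12g = (1 - t) * z * f12 + (t * y - z) * f121)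
    (d1 : (y - z) * u' = (1 - t) * z * h' + (t * y - z) * s2h')
    (d2 : (x - y) * h' = (1 - t) * y * g' + (t * x - y) * s1g')
    (d3 : (x - z) * s2h' = (1 - t) * z * s2g' + (t * x - z) * s21g')
    (d4 : (y - z) * g' = (1 - t) * z * f + (t * y - z) * f2)
    (d5 : (z - y) * s2g' = (1 - t) * y * f2 + (t * z - y) * f)
    (d6 : (x - z) * s1g' = (1 - t) * z * f1 + (t * x - z) * f12)
    (d7 : (x - y) * s21g' = (1 - t) * y * f21 + (t * x - y) * f121) : u = u' := by
  rw [mul_comm, ← eq_div_iff (by assumption)] at e1 e2 e3 e4 e5 e6 e7 d1 d2 d3 d4 d5 d6 d7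
  subst e4 e5 e6 e7 d4 d5 d6 d7
  subst e2 e3 d2 d3
  subst e1 d1
  have e1 : y - x = -(x - y) := by ring
  have e2 : z - y = -(y - z) := by ring
  rw [e1, e2]
  field_simp
  ring

lemma hecke_braid {n : ℕ} {i j k : Fin n} (hij : i ≠ j) (hjk : j ≠ k) (hik : i ≠ k)
    (f : MvPolynomial (Fin n) K) :
    hecke i j (hecke j k (hecke i j f)) = hecke j k (hecke i j (hecke j k f)) := by
  let A := algebraMap (MvPolynomial (Fin n) K) (FractionRing (MvPolynomial (Fin n) K))
  have hA : Function.Injective A := IsFractionRing.injective _ _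
  apply hA
  have s1k : Equiv.swap i j k = k := Equiv.swap_apply_of_ne_of_ne hik.symm hjk.symm
  have s2i : Equiv.swap j k i = i := Equiv.swap_apply_of_ne_of_ne hij hik
  have e1 := hecke_spec i j (hecke j k (hecke i j f))
  have e2 := hecke_spec j k (hecke i j f)
  have e3 := swapVars_hecke i j j k (hecke i j f)
  have e4 := hecke_spec i j f
  have e5 := swapVars_hecke i j i j f
  have e6 := swapVars_hecke j k i j f
  have e7 := congrArg (swapVars i j) e6
  have d1 := hecke_spec j k (hecke i j (hecke j k f))
  have d2 := hecke_spec i j (hecke j k f)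
  have d3 := swapVars_hecke j k i j (hecke j k f)
  have d4 := hecke_spec j k f
  have d5 := swapVars_hecke j k j k f
  have d6 := swapVars_hecke i j j k f
  have d7 := congrArg (swapVars j k) d6
  have hb : swapVars i j (swapVars j k (swapVars i j f)) =
      swapVars j k (swapVars i j (swapVars j k f)) := by
    unfold swapVars
    simp only [rename_rename]
    congr 2
    funext x
    exact swap_braid hij hjk hik x
  simp only [swapVars_mul, swapVars_add, swapVars_sub, swapVars_C, swapVars_X, swapVars_one,
    Equiv.swap_apply_left, Equiv.swap_apply_right, s1k, s2i, swapVars_swapVars]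
    at e1 e2 e3 e4 e5 e6 e7 d1 d2 d3 d4 d5 d6 d7
  rw [← hb] at d7
  have hne : ∀ a b : Fin n, a ≠ b → A (X a) - A (X b) ≠ 0 := by
    intro a b hab h
    rw [← map_sub, map_eq_zero_iff A hA] at h
    exact X_sub_ne hab h
  apply_fun A at e1 e2 e3 e4 e5 e6 e7 d1 d2 d3 d4 d5 d6 d7
  simp only [map_mul, map_add, map_sub, map_one] at e1 e2 e3 e4 e5 e6 e7 d1 d2 d3 d4 d5 d6 d7
  exact braid_field (A (X i)) (A (X j)) (A (X k)) (A (C tt)) (A f) _ _ _ _ _ _ _ _ _ _ _ _ _ _ _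
    _ _ _ _ (hne _ _ hij) (hne _ _ hij.symm) (hne _ _ hjk) (hne _ _ hjk.symm) (hne _ _ hik)
    e1 e2 e3 e4 e5 e6 e7 d1 d2 d3 d4 d5 d6 d7


/-! ### Uniqueness for the interpolation problem -/

lemma totalDegree_aeval_le_of_le_one {m n : ℕ} (φ : Fin m → MvPolynomial (Fin n) K)
    (hφ : ∀ i, (φ i).totalDegree ≤ 1) (f : MvPolynomial (Fin m) K) :
    (aeval φ f).totalDegree ≤ f.totalDegree := by
  rw [aeval_def, eval₂_eq']
  refine (totalDegree_finsetSum _ _).trans ?_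
  apply Finset.sup_le
  intro d hd
  refine (totalDegree_mul _ _).trans ?_
  have h1 : (algebraMap K (MvPolynomial (Fin n) K) (coeff d f)).totalDegree = 0 :=
    totalDegree_C _
  rw [h1, zero_add]
  refine (totalDegree_finsetProd _ _).trans ?_
  refine le_trans ?_ (le_totalDegree hd)
  rw [Finsupp.sum_fintype _ _ (fun _ => rfl)]
  apply Finset.sum_le_sum
  intro i _
  refine (totalDegree_pow _ _).trans ?_
  have := Nat.mul_le_mul_left (d i) (hφ i)
  omega

lemma kstat_eq {n : ℕ} (ν : Fin n → ℕ) (i : Fin n) :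
    kstat ν i = Set.ncard {p : Fin n | ν i < ν p ∨ (i < p ∧ ν p = ν i)} := by
  unfold kstat
  rw [← Set.ncard_union_eq]
  · congr 1
    ext p
    simp only [Set.mem_union, Set.mem_ofPred_eq]
    rcases lt_trichotomy p i with h | h | h
    · have : ¬ i < p := not_lt.mpr h.le
      simp [h, this]
    · subst h; simp
    · have : ¬ p < i := not_lt.mpr h.le
      simp [h, this]
      omega
  · rw [Set.disjoint_left]
    rintro p ⟨h1, _⟩ ⟨h2, _⟩
    exact absurd h1 (not_lt.mpr h2.le)

lemma kstat_cons_zero_zero {n : ℕ} (ν : Fin n → ℕ) :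
    kstat (Fin.cons 0 ν : Fin (n + 1) → ℕ) 0 = n := by
  rw [kstat_eq]
  have : {p : Fin (n + 1) | (Fin.cons 0 ν : Fin (n + 1) → ℕ) 0 < (Fin.cons 0 ν : Fin (n + 1) → ℕ) p
      ∨ (0 < p ∧ (Fin.cons 0 ν : Fin (n + 1) → ℕ) p = (Fin.cons 0 ν : Fin (n + 1) → ℕ) 0)} =
      Set.range Fin.succ := by
    ext p
    refine Fin.cases ?_ (fun p => ?_) p
    · simp
    · simp [Fin.succ_pos]
      omega
  rw [this, ← Set.image_univ, Set.ncard_image_of_injective _ (Fin.succ_injective n),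
    Set.ncard_univ, Nat.card_fin]

lemma kstat_cons_zero_succ {n : ℕ} (ν : Fin n → ℕ) (i : Fin n) :
    kstat (Fin.cons 0 ν : Fin (n + 1) → ℕ) i.succ = kstat ν i := by
  rw [kstat_eq, kstat_eq, ← Set.ncard_image_of_injective _ (Fin.succ_injective n)]
  congr 1
  ext p
  refine Fin.cases ?_ (fun p => ?_) p
  · simp
  · simp

lemma evalPt_cons_zero {n : ℕ} (ν : Fin n → ℕ) :
    evalPt (Fin.cons 0 ν : Fin (n + 1) → ℕ) = Fin.cons (tt ^ (-(n : ℤ))) (evalPt ν) := by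
  funext i
  refine Fin.cases ?_ (fun i => ?_) i
  · simp [evalPt, kstat_cons_zero_zero]
  · simp [evalPt, kstat_cons_zero_succ]

/-- The composition `(μ_n + 1, μ_1, …, μ_{n-1})`. -/
def cyc {n : ℕ} (μ : Fin (n + 1) → ℕ) : Fin (n + 1) → ℕ :=
  Fin.cons (μ (Fin.last n) + 1) (fun i => μ i.castSucc)

lemma kstat_cyc {n : ℕ} (μ : Fin (n + 1) → ℕ) (i : Fin (n + 1)) :
    kstat (cyc μ) (finRotate (n + 1) i) = kstat μ i := by
  rw [kstat_eq μ, ← Set.ncard_image_of_injective _ (finRotate (n + 1)).injective, kstat_eq]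
  congr 1
  ext p
  obtain ⟨p, rfl⟩ := (finRotate (n + 1)).surjective p
  rw [(finRotate (n + 1)).injective.mem_set_image]
  simp only [Set.mem_ofPred_eq]
  refine Fin.lastCases ?_ (fun p => ?_) p <;> refine Fin.lastCases ?_ (fun i => ?_) i
  · simp [cyc]
  · rw [finRotate_last, finRotate_of_lt (by simp)]
    simp only [cyc, Fin.val_castSucc]
    have : (⟨(i : ℕ) + 1, by omega⟩ : Fin (n + 1)) = i.succ := rfl
    rw [this]
    simp [Fin.castSucc_lt_last]
    omega
  · rw [finRotate_last, finRotate_of_lt (by simp)]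
    simp only [cyc, Fin.val_castSucc]
    have : (⟨(p : ℕ) + 1, by omega⟩ : Fin (n + 1)) = p.succ := rfl
    rw [this]
    have h2 : ¬ Fin.last n < p.castSucc := not_lt.mpr (Fin.le_last _)
    simp [Fin.succ_pos, h2]
    omega
  · rw [finRotate_of_lt (by simp), finRotate_of_lt (by simp)]
    simp only [cyc, Fin.val_castSucc]
    have : (⟨(p : ℕ) + 1, by omega⟩ : Fin (n + 1)) = p.succ := rfl
    rw [this]
    have : (⟨(i : ℕ) + 1, by omega⟩ : Fin (n + 1)) = i.succ := rfl
    rw [this]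
    simp

lemma evalPt_cyc {n : ℕ} (μ : Fin (n + 1) → ℕ) :
    evalPt (cyc μ) = Fin.cons (qq * evalPt μ (Fin.last n)) (fun i => evalPt μ i.castSucc) := by
  funext i
  refine Fin.cases ?_ (fun i => ?_) i
  · have := kstat_cyc μ (Fin.last n)
    rw [finRotate_last] at this
    have h3 : cyc μ 0 = μ (Fin.last n) + 1 := rfl
    simp only [evalPt, this, Fin.cons_zero, h3]
    ring
  · have := kstat_cyc μ i.castSucc
    rw [finRotate_of_lt (by simp)] at this
    have h2 : (⟨(i.castSucc : ℕ) + 1, by simp⟩ : Fin (n + 1)) = i.succ := rfl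
    rw [h2] at this
    have h3 : cyc μ i.succ = μ i.castSucc := rfl
    simp only [evalPt, this, Fin.cons_succ, h3]

lemma csize_cyc {n : ℕ} (μ : Fin (n + 1) → ℕ) : csize (cyc μ) = csize μ + 1 := by
  unfold csize cyc
  rw [Fin.sum_univ_succ, Fin.sum_univ_castSucc]
  simp
  ring

lemma interp_unique (n : ℕ) : ∀ (d : ℕ) (f : MvPolynomial (Fin n) K), f.totalDegree ≤ d →
    (∀ ν : Fin n → ℕ, csize ν ≤ d → eval (evalPt ν) f = 0) → f = 0 := by
  induction n with
  | zero =>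
    intro d f _ h
    have h0 := h (fun i => i.elim0) (by simp [csize])
    rw [eq_C_of_isEmpty f] at h0 ⊢
    rw [eval_C] at h0
    rw [h0, C_0]
  | succ n ihn =>
    intro d
    induction d with
    | zero =>
      intro f hf h
      have h0 := h 0 (by simp [csize])
      have hf' : f.totalDegree = 0 := by omega
      rw [totalDegree_eq_zero_iff_eq_C] at hf'
      rw [hf', eval_C] at h0
      rw [hf', h0, C_0]
    | succ d ihd =>
      intro f hf h
      set a : K := tt ^ (-(n : ℤ)) with ha
      -- restriction to the hyperplane vanishes
      have hr : aeval (Fin.cons (C a) (fun i => X i) : Fin (n + 1) → MvPolynomial (Fin n) K) f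
          = 0 := by
        apply ihn (d + 1)
        · refine (totalDegree_aeval_le_of_le_one _ ?_ f).trans hf
          intro i
          refine Fin.cases ?_ (fun i => ?_) i
          · simp
          · simp
        · intro ν hν
          have h1 := h (Fin.cons 0 ν) (by simpa [csize, Fin.sum_univ_succ] using hν)
          rw [evalPt_cons_zero] at h1
          rw [← h1, ← ha]
          rw [← coe_aeval_eq_eval, ← coe_aeval_eq_eval]
          simp only [RingHom.coe_coe]
          rw [← AlgHom.comp_apply, comp_aeval]
          congr 2
          funext i
          refine Fin.cases ?_ (fun i => ?_) i
          · simp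
          · simp
      have hroot : (finSuccEquiv K n f).eval (C a) = 0 := by
        rw [← hr, finSuccEquiv_apply]
        rw [← Polynomial.coe_evalRingHom, ← RingHom.comp_apply]
        rw [aeval_def, ← coe_eval₂Hom]
        congr 1
        apply MvPolynomial.ringHom_ext
        · intro r; simp
        · intro i
          refine Fin.cases ?_ (fun i => ?_) i
          · simp
          · simp
      obtain ⟨G, hG⟩ := Polynomial.dvd_iff_isRoot.mpr hroot
      set g := (finSuccEquiv K n).symm G with hg
      have hfg : f = (X 0 - C a) * g := by
        apply (finSuccEquiv K n).injective
        rw [hG, map_mul, hg, AlgEquiv.apply_symm_apply, map_sub, finSuccEquiv_X_zero]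
        congr 2
        simp [finSuccEquiv_apply]
      by_contra hf0
      have hg0 : g ≠ 0 := by
        intro h0; rw [h0, mul_zero] at hfg; exact hf0 hfg
      have hX0 : (X 0 - C a : MvPolynomial (Fin (n + 1)) K) ≠ 0 := by
        intro h0; rw [h0, zero_mul] at hfg; exact hf0 hfg
      have hX1 : 1 ≤ (X 0 - C a : MvPolynomial (Fin (n + 1)) K).totalDegree := by
        have : Finsupp.single (0 : Fin (n + 1)) 1 ∈
            (X 0 - C a : MvPolynomial (Fin (n + 1)) K).support := by
          rw [mem_support_iff, coeff_sub, coeff_X, coeff_C,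
            if_neg (Finsupp.single_ne_zero.mpr one_ne_zero).symm]
          simp
        have := le_totalDegree this
        simpa using this
      have hdeg : g.totalDegree ≤ d := by
        rw [hfg, totalDegree_mul_of_isDomain hX0 hg0] at hf
        omega
      have hg' : aeval (Fin.cons (C qq * X (Fin.last n)) (fun i => X i.castSucc) :
          Fin (n + 1) → MvPolynomial (Fin (n + 1)) K) g = 0 := by
        apply ihd
        · refine (totalDegree_aeval_le_of_le_one _ ?_ g).trans hdeg
          intro i
          refine Fin.cases ?_ (fun i => ?_) i
          · exact (isHomogeneous_C_mul_X _ _).totalDegree_le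
          · simp
        · intro μ hμ
          have h1 := h (cyc μ) (by rw [csize_cyc]; omega)
          rw [hfg, map_mul] at h1
          rcases mul_eq_zero.mp h1 with h2 | h2
          · exfalso
            rw [map_sub, eval_X, eval_C, sub_eq_zero, ha] at h2
            have h3 : qq ^ (cyc μ 0) * tt ^ (-(kstat (cyc μ) 0 : ℤ)) = qq ^ 0 * tt ^ (-(n : ℤ)) := by
              rw [pow_zero, one_mul]; exact h2
            have := qt_inj _ _ _ _ h3
            simp [cyc] at this
          · rw [evalPt_cyc] at h2
            rw [← h2]
            rw [← coe_aeval_eq_eval, ← coe_aeval_eq_eval]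
            simp only [RingHom.coe_coe]
            rw [← AlgHom.comp_apply, comp_aeval]
            congr 2
            funext i
            refine Fin.cases ?_ (fun i => ?_) i
            · simp
            · simp
      apply hg0
      have h3 := congrArg (aeval (Fin.snoc (fun i => X i.succ) (C qq⁻¹ * X 0) :
        Fin (n + 1) → MvPolynomial (Fin (n + 1)) K)) hg'
      rw [map_zero, ← AlgHom.comp_apply, comp_aeval] at h3
      rw [← h3]
      conv_lhs => rw [← aeval_X_left_apply g]
      congr 2
      funext i
      refine Fin.cases ?_ (fun i => ?_) i
      · simp [← mul_assoc, ← C_mul, qq_ne_zero]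
      · simp

/-! ### The Hecke operator and evaluations -/

lemma swap_adj_lt {n : ℕ} {i j : Fin n} (hij : (j : ℕ) = (i : ℕ) + 1) {p q : Fin n}
    (hpq : p < q) (h : ¬ (p = i ∧ q = j)) : Equiv.swap i j p < Equiv.swap i j q := by
  simp only [Equiv.swap_apply_def]
  split_ifs <;> simp only [Fin.lt_def, Fin.ext_iff] at * <;> omega

lemma kstat_swap {n : ℕ} {i j : Fin n} (hij : (j : ℕ) = (i : ℕ) + 1) (ν : Fin n → ℕ)
    (hν : ν i ≠ ν j) (m : Fin n) :
    kstat (ν ∘ Equiv.swap i j) m = kstat ν (Equiv.swap i j m) := by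
  rw [kstat_eq (ν ∘ Equiv.swap i j),
    ← Set.ncard_image_of_injective _ (Equiv.swap i j).injective, kstat_eq]
  congr 1
  ext p
  obtain ⟨p, rfl⟩ := (Equiv.swap i j).surjective p
  rw [(Equiv.swap i j).injective.mem_set_image]
  simp only [Set.mem_ofPred_eq, Function.comp]
  apply or_congr Iff.rfl
  apply and_congr_left
  intro he
  constructor
  · intro h
    apply swap_adj_lt hij h
    rintro ⟨rfl, rfl⟩
    rw [Equiv.swap_apply_left, Equiv.swap_apply_right] at he
    exact hν he
  · intro h
    have := swap_adj_lt hij h ?_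
    · simpa using this
    · rintro ⟨h1, h2⟩
      rw [h1, h2] at he
      exact hν he.symm

lemma evalPt_swap {n : ℕ} {i j : Fin n} (hij : (j : ℕ) = (i : ℕ) + 1) (ν : Fin n → ℕ)
    (hν : ν i ≠ ν j) : evalPt (ν ∘ Equiv.swap i j) = evalPt ν ∘ Equiv.swap i j := by
  funext m
  simp only [evalPt, kstat_swap hij ν hν, Function.comp]

lemma kstat_adj_eq {n : ℕ} {i j : Fin n} (hij : (j : ℕ) = (i : ℕ) + 1) (ν : Fin n → ℕ)
    (hν : ν i = ν j) : kstat ν i = kstat ν j + 1 := by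
  rw [kstat_eq, kstat_eq, ← Set.ncard_insert_of_notMem (a := j)]
  · congr 1
    ext p
    simp only [Set.mem_ofPred_eq, Set.mem_insert_iff, hν]
    have : i < p ↔ p = j ∨ j < p := by
      simp only [Fin.lt_def, Fin.ext_iff]; omega
    rw [this]
    constructor
    · tauto
    · rintro (h | h)
      · right; subst h; simp
      · tauto
  · simp

lemma evalPt_adj_eq {n : ℕ} {i j : Fin n} (hij : (j : ℕ) = (i : ℕ) + 1) (ν : Fin n → ℕ)
    (hν : ν i = ν j) : evalPt ν j = tt * evalPt ν i := by
  have ht := tt_ne_zero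
  simp only [evalPt, kstat_adj_eq hij ν hν, hν]
  rw [zpow_neg, zpow_neg, zpow_natCast, zpow_natCast]
  field_simp
  ring

lemma evalPt_ne_zero {n : ℕ} (ν : Fin n → ℕ) (i : Fin n) : evalPt ν i ≠ 0 :=
  mul_ne_zero (pow_ne_zero _ qq_ne_zero) (zpow_ne_zero _ tt_ne_zero)

lemma eval_hecke {n : ℕ} (i j : Fin n) (f : MvPolynomial (Fin n) K) (p : Fin n → K) :
    (p i - p j) * eval p (hecke i j f) =
      (1 - tt) * p j * eval p f + (tt * p i - p j) * eval (p ∘ Equiv.swap i j) f := by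
  have h := congrArg (eval p) (hecke_spec i j f)
  simp only [map_mul, map_sub, map_add, map_one, eval_X, eval_C, swapVars, eval_rename] at h
  exact h

lemma eval_hecke_of_eq {n : ℕ} {i j : Fin n} (hij : (j : ℕ) = (i : ℕ) + 1) (ν : Fin n → ℕ)
    (hν : ν i = ν j) (f : MvPolynomial (Fin n) K) :
    eval (evalPt ν) (hecke i j f) = tt * eval (evalPt ν) f := by
  have h := eval_hecke i j f (evalPt ν)
  rw [evalPt_adj_eq hij ν hν] at h
  have h1 : (1 - tt) * evalPt ν i ≠ 0 :=
    mul_ne_zero (sub_ne_zero.mpr tt_ne_one.symm) (evalPt_ne_zero ν i)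
  apply mul_left_cancel₀ h1
  linear_combination h

lemma eval_hecke_of_ne {n : ℕ} {i j : Fin n} (hij : (j : ℕ) = (i : ℕ) + 1) (ν : Fin n → ℕ)
    (hν : ν i ≠ ν j) (f : MvPolynomial (Fin n) K) (h0 : eval (evalPt ν) f = 0)
    (h1 : eval (evalPt (ν ∘ Equiv.swap i j)) f = 0) :
    eval (evalPt ν) (hecke i j f) = 0 := by
  have h := eval_hecke i j f (evalPt ν)
  rw [← evalPt_swap hij ν hν, h0, h1, mul_zero, mul_zero, add_zero] at h
  rcases mul_eq_zero.mp h with h2 | h2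
  · exfalso
    exact hν (qt_inj _ _ _ _ (sub_eq_zero.mp h2))
  · exact h2

lemma hecke_totalDegree {n : ℕ} {i j : Fin n} (hij : i ≠ j) (f : MvPolynomial (Fin n) K) :
    (hecke i j f).totalDegree ≤ f.totalDegree := by
  by_cases h0 : hecke i j f = 0
  · rw [h0]; simp
  have h := hecke_spec i j f
  have h1 := totalDegree_mul_of_isDomain (X_sub_ne hij) h0
  have h2 : (X i - X j : MvPolynomial (Fin n) K).totalDegree = 1 :=
    ((isHomogeneous_X K i).sub (isHomogeneous_X K j)).totalDegree (X_sub_ne hij)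
  rw [h, h2] at h1
  have h3 : ((1 - C tt) * X j * f + (C tt * X i - X j) * swapVars i j f).totalDegree ≤
      1 + f.totalDegree := by
    refine (totalDegree_add _ _).trans (max_le ?_ ?_)
    · refine (totalDegree_mul _ _).trans (Nat.add_le_add_right ?_ _)
      rw [← C_1, ← C_sub]
      exact (isHomogeneous_C_mul_X _ _).totalDegree_le
    · refine (totalDegree_mul _ _).trans (Nat.add_le_add ?_ ?_)
      · exact ((isHomogeneous_C_mul_X _ _).sub (isHomogeneous_X K j)).totalDegree_le
      · exact totalDegree_rename_le _ _
  omega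

lemma csize_swap {n : ℕ} (i j : Fin n) (ν : Fin n → ℕ) :
    csize (ν ∘ Equiv.swap i j) = csize ν := by
  unfold csize
  exact Equiv.sum_comp (Equiv.swap i j) ν

lemma comp_swap_swap {n : ℕ} {β : Type*} (i j : Fin n) (ν : Fin n → β) :
    (ν ∘ Equiv.swap i j) ∘ Equiv.swap i j = ν := by
  funext x; simp

lemma comp_swap_of_eq {n : ℕ} {β : Type*} (i j : Fin n) (ν : Fin n → β) (h : ν i = ν j) :
    ν ∘ Equiv.swap i j = ν := by
  funext x
  simp only [Function.comp, Equiv.swap_apply_def]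
  split_ifs with h1 h2
  · rw [h1, h]
  · rw [h2, h]
  · rfl

lemma hecke_Estar {n : ℕ} {i j : Fin n} (hij : (j : ℕ) = (i : ℕ) + 1) (l : Fin n → ℕ)
    (hl : l i = l j) : hecke i j (Estar l) = C tt * Estar l := by
  have hne := ne_of_adj hij
  unfold Estar
  split_ifs with h
  · obtain ⟨h1, _, h3⟩ := h.choose_spec
    set f := h.choose
    rw [← sub_eq_zero]
    apply interp_unique n (csize l)
    · refine (totalDegree_sub _ _).trans (max_le ((hecke_totalDegree hne f).trans h1) ?_)
      refine (totalDegree_mul _ _).trans ?_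
      rw [totalDegree_C, zero_add]
      exact h1
    · intro ν hν
      rw [map_sub, map_mul, eval_C]
      by_cases he : ν i = ν j
      · rw [eval_hecke_of_eq hij ν he, sub_self]
      · have hnl : ν ≠ l := by rintro rfl; exact he hl
        have hz := h3 ν hν hnl
        rw [eval_hecke_of_ne hij ν he f hz ?_, hz, mul_zero, sub_zero]
        apply h3
        · rw [csize_swap]; exact hν
        · intro hsl
          apply hnl
          rw [← comp_swap_swap i j ν, hsl, comp_swap_of_eq i j l hl]
  · have h0 := hecke_smul hne 0 (0 : MvPolynomial (Fin n) K)
    simpa using h0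

/-! ### Homogeneous components -/

lemma homogeneousComponent_linear_mul {n : ℕ} (d : ℕ) (a f : MvPolynomial (Fin n) K)
    (ha : a.IsHomogeneous 1) :
    homogeneousComponent (d + 1) (a * f) = a * homogeneousComponent d f := by
  let _ : GradedAlgebra (homogeneousSubmodule (Fin n) K) := MvPolynomial.gradedAlgebra
  have := DirectSum.coe_decompose_mul_of_left_mem_of_le (homogeneousSubmodule (Fin n) K)
    (a := a) (b := f) (i := 1) (n := d + 1) ha (by omega)
  have key : ∀ (φ : MvPolynomial (Fin n) K) (m : ℕ),
      ((DirectSum.decompose (homogeneousSubmodule (Fin n) K) φ m : homogeneousSubmodule (Fin n) K m) :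
        MvPolynomial (Fin n) K) = homogeneousComponent m φ :=
    fun φ m => decomposition.decompose'_apply φ m
  rw [key, key] at this
  exact this

lemma hecke_homogeneousComponent {n : ℕ} {i j : Fin n} (hij : i ≠ j) (d : ℕ)
    (f : MvPolynomial (Fin n) K) :
    hecke i j (homogeneousComponent d f) = homogeneousComponent d (hecke i j f) := by
  apply hecke_eq hij
  have h := congrArg (homogeneousComponent (d + 1)) (hecke_spec i j f)
  rw [homogeneousComponent_linear_mul _ _ _ ((isHomogeneous_X K i).sub (isHomogeneous_X K j)),
    map_add, homogeneousComponent_linear_mul, homogeneousComponent_linear_mul] at h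
  · rw [h]
    unfold swapVars
    rw [rename_homogeneousComponent]
  · exact ((isHomogeneous_C_mul_X _ _).sub (isHomogeneous_X K j))
  · rw [← C_1, ← C_sub]
    exact (isHomogeneous_C_mul_X _ _)

/-! ### ascNersions and words -/

/-- Number of ascending pairs. -/
def ascN {n : ℕ} (μ : Fin n → ℕ) : ℕ :=
  Set.ncard {p : Fin n × Fin n | p.1 < p.2 ∧ μ p.1 < μ p.2}

lemma ascN_swap {n : ℕ} {i j : Fin n} (hij : (j : ℕ) = (i : ℕ) + 1) (μ : Fin n → ℕ)
    (h : μ j < μ i) : ascN (μ ∘ Equiv.swap i j) = ascN μ + 1 := by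
  have hlt : i < j := by rw [Fin.lt_def]; omega
  have hinj : Function.Injective (Prod.map (Equiv.swap i j) (Equiv.swap i j)) :=
    (Equiv.swap i j).injective.prodMap (Equiv.swap i j).injective
  unfold ascN
  rw [← Set.ncard_image_of_injective {p : Fin n × Fin n | p.1 < p.2 ∧ μ p.1 < μ p.2} hinj,
    ← Set.ncard_insert_of_notMem (a := (i, j))]
  · congr 1
    ext ⟨p, q⟩
    simp only [Set.mem_ofPred_eq, Set.mem_insert_iff, Set.mem_image, Prod.mk.injEq, Prod.exists,
      Prod.map_apply, Function.comp]
    constructor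
    · rintro ⟨h1, h2⟩
      by_cases he : p = i ∧ q = j
      · exact Or.inl he
      · right
        exact ⟨_, _, ⟨swap_adj_lt hij h1 he, h2⟩, by simp, by simp⟩
    · rintro (⟨rfl, rfl⟩ | ⟨a, b, ⟨h1, h2⟩, rfl, rfl⟩)
      · simp [hlt, h]
      · refine ⟨swap_adj_lt hij h1 ?_, by simpa using h2⟩
        rintro ⟨rfl, rfl⟩
        omega
  · rintro ⟨⟨a, b⟩, ⟨h1, h2⟩, h3⟩
    simp only [Prod.map_apply, Prod.mk.injEq] at h3 h1 h2
    obtain ⟨h3, h4⟩ := h3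
    have ha : a = j := by
      have := congrArg (Equiv.swap i j) h3
      simpa using this
    have hb : b = i := by
      have := congrArg (Equiv.swap i j) h4
      simpa using this
    subst ha hb
    exact absurd h1 (not_lt.mpr hlt.le)

lemma ascN_swap' {n : ℕ} {i j : Fin n} (hij : (j : ℕ) = (i : ℕ) + 1) (μ : Fin n → ℕ)
    (h : μ i < μ j) : ascN (μ ∘ Equiv.swap i j) + 1 = ascN μ := by
  have := ascN_swap hij (μ ∘ Equiv.swap i j) (by simpa using h)
  rw [comp_swap_swap] at this
  exact this.symm

lemma ascN_swap_le {n : ℕ} {i j : Fin n} (hij : (j : ℕ) = (i : ℕ) + 1) (μ : Fin n → ℕ) :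
    ascN (μ ∘ Equiv.swap i j) ≤ ascN μ + 1 := by
  rcases lt_trichotomy (μ i) (μ j) with h | h | h
  · have := ascN_swap' hij μ h; omega
  · rw [comp_swap_of_eq i j μ h]; omega
  · exact (ascN_swap hij μ h).le

lemma exists_ascent {n : ℕ} (μ : Fin n → ℕ) (h : ¬ IsPartition μ) :
    ∃ i j : Fin n, (j : ℕ) = (i : ℕ) + 1 ∧ μ i < μ j := by
  by_contra hc
  push Not at hc
  apply h
  have key : ∀ (d : ℕ) (i j : Fin n), (j : ℕ) = i + d → μ j ≤ μ i := by
    intro d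
    induction d with
    | zero => intro i j hd; have : j = i := Fin.ext (by omega); rw [this]
    | succ d ih =>
      intro i j hd
      have hlt : (i : ℕ) + d < n := by omega
      exact (hc ⟨i + d, hlt⟩ j (by simp; omega)).trans (ih i ⟨i + d, hlt⟩ rfl)
  intro i j hij
  exact key (j - i) i j (by have : (i : ℕ) ≤ j := hij; omega)

lemma ascN_partition {n : ℕ} (μ : Fin n → ℕ) (h : IsPartition μ) : ascN μ = 0 := by
  unfold ascN
  have : {p : Fin n × Fin n | p.1 < p.2 ∧ μ p.1 < μ p.2} = ∅ := by
    ext ⟨p, q⟩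
    simp only [Set.mem_ofPred_eq, Set.mem_empty_iff_false, iff_false]
    rintro ⟨h1, h2⟩
    have := h p q h1.le
    omega
  rw [this, Set.ncard_empty]

lemma permLength_eq {n : ℕ} (σ : Equiv.Perm (Fin n)) :
    permLength σ = ascN (fun p => n - (σ p : ℕ)) := by
  unfold permLength ascN
  congr 1
  ext ⟨p, q⟩
  simp only [Set.mem_ofPred_eq, Fin.lt_def]
  omega

lemma permLength_mul_swap {n : ℕ} (σ : Equiv.Perm (Fin n)) (i j : Fin n) :
    permLength (σ * Equiv.swap i j) = ascN ((fun p => n - (σ p : ℕ)) ∘ Equiv.swap i j) := by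
  rw [permLength_eq]
  rfl

lemma permLength_one {n : ℕ} : permLength (1 : Equiv.Perm (Fin n)) = 0 := by
  rw [permLength_eq]
  apply ascN_partition
  intro i j h
  have : (i : ℕ) ≤ j := h
  simp only [Equiv.Perm.coe_one, id]
  omega

lemma permLength_word {n : ℕ} (w : List {i : ℕ // i + 1 < n}) :
    permLength (w.map adjSwap).prod ≤ w.length := by
  induction w using List.reverseRecOn with
  | nil => simp [permLength_one]
  | append_singleton w a ih =>
    rw [List.map_append, List.prod_append, List.map_singleton, List.prod_singleton,
      List.length_append, List.length_singleton]
    unfold adjSwap at ih ⊢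
    rw [permLength_mul_swap]
    refine (ascN_swap_le rfl _).trans ?_
    rw [← permLength_eq]
    omega

lemma exists_reduced {n : ℕ} : ∀ (d : ℕ) (σ : Equiv.Perm (Fin n)), permLength σ = d →
    ∃ w, IsReducedWordOf w σ := by
  intro d
  induction d with
  | zero =>
    intro σ h
    refine ⟨[], ?_, by rw [h]; rfl⟩
    rw [List.map_nil, List.prod_nil]
    have hm : StrictMono σ := by
      intro p q hpq
      by_contra hc
      have hne : σ q ≠ σ p := fun h => hpq.ne' (σ.injective h)
      have hlt : σ q < σ p := lt_of_le_of_ne (not_lt.mp hc) hne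
      unfold permLength at h
      rw [Set.ncard_eq_zero] at h
      have : (p, q) ∈ ({p : Fin n × Fin n | p.1 < p.2 ∧ σ p.2 < σ p.1}) := ⟨hpq, hlt⟩
      rw [h] at this
      exact this
    ext x
    have h1 : (⇑σ : Fin n → Fin n) = id := (StrictMono.range_inj hm strictMono_id).mp
      (by rw [σ.surjective.range_eq]; simp)
    rw [h1]; rfl
  | succ d ih =>
    intro σ h
    have hnp : ¬ IsPartition (fun p => n - (σ p : ℕ)) := by
      intro hp
      have := ascN_partition _ hp
      rw [← permLength_eq] at this
      omega
    obtain ⟨i, j, hij, hlt⟩ := exists_ascent _ hnp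
    have h1 := ascN_swap' hij (fun p => n - (σ p : ℕ)) hlt
    rw [← permLength_mul_swap, ← permLength_eq] at h1
    obtain ⟨w, hw1, hw2⟩ := ih (σ * Equiv.swap i j) (by omega)
    have hj := j.2
    refine ⟨w ++ [⟨i, by omega⟩], ?_, ?_⟩
    · rw [List.map_append, List.prod_append, List.map_singleton, List.prod_singleton, hw1]
      have : adjSwap (n := n) ⟨i, by omega⟩ = Equiv.swap i j := by
        unfold adjSwap
        congr 1
        exact Fin.ext hij.symm
      rw [this, mul_assoc, Equiv.swap_mul_self, mul_one]
    · rw [List.length_append, hw2, List.length_singleton]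
      omega

lemma permAct_swap_mul {n : ℕ} (σ : Equiv.Perm (Fin n)) (i j : Fin n) (l : Fin n → ℕ) :
    permAct (Equiv.swap i j * σ) l = permAct σ l ∘ Equiv.swap i j := by
  funext x
  simp only [permAct, Function.comp]
  congr 1

lemma ascN_word {n : ℕ} (w : List {i : ℕ // i + 1 < n}) (l : Fin n → ℕ) (hl : IsPartition l) :
    ascN (permAct (w.map adjSwap).prod l) ≤ w.length := by
  induction w with
  | nil =>
    have : permAct 1 l = l := rfl
    simp [this, ascN_partition l hl]
  | cons a w ih =>
    rw [List.map_cons, List.prod_cons, List.length_cons]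
    unfold adjSwap at ih ⊢
    rw [permAct_swap_mul]
    refine (ascN_swap_le rfl _).trans ?_
    omega

/-- Polynomials obtained by applying Hecke operators along descents. -/
inductive Reach {n : ℕ} : (Fin n → ℕ) → MvPolynomial (Fin n) K → Prop
  | base (l : Fin n → ℕ) (hl : IsPartition l) : Reach l (Estar l)
  | step (μ : Fin n → ℕ) (F : MvPolynomial (Fin n) K) (i j : Fin n)
      (hij : (j : ℕ) = (i : ℕ) + 1) (h : μ j < μ i) (hF : Reach μ F) :
      Reach (μ ∘ Equiv.swap i j) (hecke i j F)

lemma reach_word {n : ℕ} (w : List {i : ℕ // i + 1 < n}) (l : Fin n → ℕ) (hl : IsPartition l)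
    (hw : ascN (permAct (w.map adjSwap).prod l) = w.length) :
    Reach (permAct (w.map adjSwap).prod l) (Tword w (Estar l)) := by
  induction w with
  | nil => exact Reach.base l hl
  | cons a w ih =>
    have hle := ascN_word w l hl
    rw [List.map_cons, List.prod_cons] at hw ⊢
    rw [List.length_cons] at hw
    have he : permAct (adjSwap a * (w.map adjSwap).prod) l = permAct (w.map adjSwap).prod l ∘
      Equiv.swap ⟨a.1, Nat.lt_of_succ_lt a.2⟩ ⟨a.1 + 1, a.2⟩ := permAct_swap_mul _ _ _ _
    rw [he] at hw ⊢
    set κ := permAct (w.map adjSwap).prod l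
    have hle2 := ascN_swap_le (i := ⟨a.1, Nat.lt_of_succ_lt a.2⟩) (j := ⟨a.1 + 1, a.2⟩) rfl κ
    have hd : κ ⟨a.1 + 1, a.2⟩ < κ ⟨a.1, Nat.lt_of_succ_lt a.2⟩ := by
      rcases lt_trichotomy (κ ⟨a.1, Nat.lt_of_succ_lt a.2⟩) (κ ⟨a.1 + 1, a.2⟩) with h | h | h
      · have := ascN_swap' rfl κ h; omega
      · rw [comp_swap_of_eq _ _ κ h] at hw; omega
      · exact h
    exact Reach.step κ _ _ _ rfl hd (ih (by omega))

lemma exists_word {n : ℕ} : ∀ (d : ℕ) (μ : Fin n → ℕ), ascN μ = d →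
    ∃ (w : List {i : ℕ // i + 1 < n}) (l : Fin n → ℕ), IsPartition l ∧
      permAct (w.map adjSwap).prod l = μ ∧ w.length = d := by
  intro d
  induction d with
  | zero =>
    intro μ h
    refine ⟨[], μ, ?_, rfl, rfl⟩
    by_contra hc
    obtain ⟨i, j, hij, hlt⟩ := exists_ascent μ hc
    have := ascN_swap' hij μ hlt
    omega
  | succ d ih =>
    intro μ h
    have hnp : ¬ IsPartition μ := by
      intro hp
      have := ascN_partition _ hp
      omega
    obtain ⟨i, j, hij, hlt⟩ := exists_ascent _ hnp
    have h1 := ascN_swap' hij _ hlt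
    obtain ⟨w, l, hl, hw, hwl⟩ := ih (μ ∘ Equiv.swap i j) (by omega)
    have hj := j.2
    refine ⟨⟨i, by omega⟩ :: w, l, hl, ?_, by simp [hwl]⟩
    have : adjSwap (n := n) ⟨i, by omega⟩ = Equiv.swap i j := by
      unfold adjSwap
      congr 1
      exact Fin.ext hij.symm
    rw [List.map_cons, List.prod_cons, this, permAct_swap_mul, hw, comp_swap_swap]

lemma partition_unique {n : ℕ} (l l' : Fin n → ℕ) (hl : IsPartition l) (hl' : IsPartition l')
    (σ : Equiv.Perm (Fin n)) (h : permAct σ l = l') : l = l' := by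
  unfold permAct at h
  have h1 : Antitone l := fun i j hij => hl i j hij
  have h2 : Antitone (l ∘ σ.symm) := by rw [h]; exact fun i j hij => hl' i j hij
  rw [← h]
  have := Tuple.unique_antitone (f := l) (σ := 1) (τ := σ.symm) (by simpa using h1) h2
  simpa using this

lemma reach_fstar {n : ℕ} (μ : Fin n → ℕ) : Reach μ (fstar μ) := by
  obtain ⟨w0, l0, hl0, hw0, hlen0⟩ := exists_word (ascN μ) μ rfl
  have hex : ∃ l, IsPartition l ∧ μ ∈ Sn l := ⟨l0, hl0, _, hw0⟩
  have hs : IsPartition (sortDesc μ) ∧ μ ∈ Sn (sortDesc μ) := by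
    unfold sortDesc
    rw [dif_pos hex]
    exact hex.choose_spec
  have hsl : sortDesc μ = l0 := by
    obtain ⟨hp, σ, hσ⟩ := hs
    apply partition_unique _ _ hp hl0 ((w0.map adjSwap).prod⁻¹ * σ)
    rw [← hσ] at hw0
    funext x
    have := congrFun hw0 ((w0.map adjSwap).prod x)
    simp only [permAct, Function.comp, Equiv.symm_apply_apply] at this ⊢
    rw [this]
    rfl
  have hex2 : ∃ σ, permAct σ l0 = μ ∧ ∀ τ, permAct τ l0 = μ → permLength σ ≤ permLength τ := by
    obtain ⟨σ, hσ, hmin⟩ := Set.exists_min_image {σ : Equiv.Perm (Fin n) | permAct σ l0 = μ}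
      permLength (Set.toFinite _) ⟨_, hw0⟩
    exact ⟨σ, hσ, hmin⟩
  unfold fstar
  rw [hsl]
  have hsm : permAct (sigmaMin l0 μ) l0 = μ ∧
      ∀ τ, permAct τ l0 = μ → permLength (sigmaMin l0 μ) ≤ permLength τ := by
    unfold sigmaMin
    rw [dif_pos hex2]
    exact hex2.choose_spec
  obtain ⟨hs1, hs2⟩ := hsm
  set σ := sigmaMin l0 μ
  have hex3 := exists_reduced _ σ rfl
  unfold Tsigma
  rw [dif_pos hex3]
  obtain ⟨hr1, hr2⟩ := hex3.choose_spec
  set w := hex3.choose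
  have e1 := hs2 _ hw0
  have e2 := permLength_word w0
  have e3 := ascN_word w l0 hl0
  have := reach_word w l0 hl0 (by rw [hr1, hs1] at e3 ⊢; omega)
  rw [hr1, hs1] at this
  exact this

/-! ### Well-definedness and the Hecke relations for `fstar` -/

lemma reach_inv {n : ℕ} {μ : Fin n → ℕ} {F : MvPolynomial (Fin n) K} (h : Reach μ F) :
    (IsPartition μ ∧ F = Estar μ) ∨ ∃ (i j : Fin n) (G : MvPolynomial (Fin n) K),
      (j : ℕ) = (i : ℕ) + 1 ∧ μ i < μ j ∧ Reach (μ ∘ Equiv.swap i j) G ∧ F = hecke i j G := by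
  cases h with
  | base _ hl => exact Or.inl ⟨hl, rfl⟩
  | step κ G i j hij h hF =>
    refine Or.inr ⟨i, j, G, hij, by simpa using h, ?_, rfl⟩
    rw [comp_swap_swap]
    exact hF

lemma reach_step' {n : ℕ} {μ : Fin n → ℕ} {G : MvPolynomial (Fin n) K} {i j : Fin n}
    (hij : (j : ℕ) = (i : ℕ) + 1) (h : μ i < μ j) (hG : Reach (μ ∘ Equiv.swap i j) G) :
    Reach μ (hecke i j G) := by
  have := Reach.step _ G i j hij (by simpa using h) hG
  rwa [comp_swap_swap] at this

lemma not_partition_of_ascent {n : ℕ} {μ : Fin n → ℕ} {i j : Fin n}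
    (hij : (j : ℕ) = (i : ℕ) + 1) (h : μ i < μ j) : ¬ IsPartition μ := by
  intro hp
  have := hp i j (by rw [Fin.le_def]; omega)
  omega

/-- Composite identity behind the braid relation. -/
lemma comp_braid {n : ℕ} {i j k : Fin n} (hij : i ≠ j) (hjk : j ≠ k) (hik : i ≠ k)
    (μ : Fin n → ℕ) :
    ((μ ∘ Equiv.swap i j) ∘ Equiv.swap j k) ∘ Equiv.swap i j =
      ((μ ∘ Equiv.swap j k) ∘ Equiv.swap i j) ∘ Equiv.swap j k := by
  funext x
  simp only [Function.comp]
  rw [swap_braid hij hjk hik]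

lemma reach_unique {n : ℕ} : ∀ (d : ℕ) (μ : Fin n → ℕ), ascN μ = d →
    ∀ F G : MvPolynomial (Fin n) K, Reach μ F → Reach μ G → F = G := by
  intro d
  induction d using Nat.strong_induction_on with
  | _ d ih =>
  intro μ hd F F' hF hF'
  have braid : ∀ (i j k : Fin n) (G G' : MvPolynomial (Fin n) K), (j : ℕ) = (i : ℕ) + 1 →
      (k : ℕ) = (j : ℕ) + 1 → μ i < μ j → μ j < μ k → Reach (μ ∘ Equiv.swap i j) G →
      Reach (μ ∘ Equiv.swap j k) G' → hecke i j G = hecke j k G' := by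
    intro i j k G G' hij hjk h1 h2 hG hG'
    have nij := ne_of_adj hij
    have njk := ne_of_adj hjk
    have nik : i ≠ k := by intro h; rw [h] at hij; omega
    have s1k : Equiv.swap i j k = k := Equiv.swap_apply_of_ne_of_ne nik.symm njk.symm
    have s2i : Equiv.swap j k i = i := Equiv.swap_apply_of_ne_of_ne nij nik
    set κ := ((μ ∘ Equiv.swap i j) ∘ Equiv.swap j k) ∘ Equiv.swap i j with hκ
    have hκ' : κ = ((μ ∘ Equiv.swap j k) ∘ Equiv.swap i j) ∘ Equiv.swap j k :=
      comp_braid nij njk nik μ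
    have hH := reach_fstar κ
    have e1 := ascN_swap' hij μ h1
    have e2 := ascN_swap' hjk μ h2
    have r1 : Reach (μ ∘ Equiv.swap i j) (hecke j k (hecke i j (fstar κ))) := by
      apply reach_step' hjk
      · simp [s1k]; omega
      · apply reach_step' hij
        · simp [s1k, s2i]; omega
        · exact hH
    have r2 : Reach (μ ∘ Equiv.swap j k) (hecke i j (hecke j k (fstar κ))) := by
      apply reach_step' hij
      · simp [s2i]; omega
      · apply reach_step' hjk
        · simp [s1k, s2i]; omega
        · rw [← hκ']; exact hH
    rw [ih _ (by omega) _ rfl _ _ hG r1, ih _ (by omega) _ rfl _ _ hG' r2]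
    exact hecke_braid nij njk nik _
  rcases reach_inv hF with ⟨hp, rfl⟩ | ⟨i, j, G, hij, h, hG, rfl⟩
  · rcases reach_inv hF' with ⟨_, rfl⟩ | ⟨i, j, G, hij, h, hG, rfl⟩
    · rfl
    · exact absurd hp (not_partition_of_ascent hij h)
  · rcases reach_inv hF' with ⟨hp, rfl⟩ | ⟨i', j', G', hij', h', hG', rfl⟩
    · exact absurd hp (not_partition_of_ascent hij h)
    · by_cases c1 : i = i'
      · subst c1
        have : j = j' := Fin.ext (by omega)
        subst this
        have e1 := ascN_swap' hij μ h
        rw [ih _ (by omega) _ rfl _ _ hG hG']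
      by_cases c2 : j = i'
      · subst c2
        exact braid i j j' G G' hij hij' h h' hG hG'
      by_cases c3 : j' = i
      · subst c3
        exact (braid i' j' j G' G hij' hij h' h hG' hG).symm
      have c4 : j ≠ j' := by
        intro hh
        apply c1
        apply Fin.ext
        rw [hh] at hij
        omega
      have c3' : i ≠ j' := fun hh => c3 hh.symm
      have nij := ne_of_adj hij
      have nij' := ne_of_adj hij'
      have hc : (μ ∘ Equiv.swap i j) ∘ Equiv.swap i' j' =
          (μ ∘ Equiv.swap i' j') ∘ Equiv.swap i j := by
        funext x
        simp only [Function.comp]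
        rw [swap_comm' c1 c3' c2 c4]
      have hH := reach_fstar ((μ ∘ Equiv.swap i j) ∘ Equiv.swap i' j')
      have e1 := ascN_swap' hij μ h
      have e2 := ascN_swap' hij' μ h'
      have r1 := reach_step' (μ := μ ∘ Equiv.swap i j) hij' (by
        simp only [Function.comp]
        rw [Equiv.swap_apply_of_ne_of_ne (Ne.symm c1) (Ne.symm c2),
          Equiv.swap_apply_of_ne_of_ne (Ne.symm c3') (Ne.symm c4)]
        exact h') hH
      rw [hc] at hH
      have r2 := reach_step' (μ := μ ∘ Equiv.swap i' j') hij (by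
        simp only [Function.comp]
        rw [Equiv.swap_apply_of_ne_of_ne c1 c3', Equiv.swap_apply_of_ne_of_ne c2 c4]
        exact h) hH
      rw [ih _ (by omega) _ rfl _ _ hG r1, ih _ (by omega) _ rfl _ _ hG' r2, hc]
      exact hecke_comm nij nij' c1 c3' c2 c4 _

lemma fstar_step {n : ℕ} {i j : Fin n} (hij : (j : ℕ) = (i : ℕ) + 1) (μ : Fin n → ℕ)
    (h : μ j < μ i) : hecke i j (fstar μ) = fstar (μ ∘ Equiv.swap i j) :=
  reach_unique _ _ rfl _ _ (Reach.step μ _ i j hij h (reach_fstar μ)) (reach_fstar _)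

lemma fstar_step' {n : ℕ} {i j : Fin n} (hij : (j : ℕ) = (i : ℕ) + 1) (μ : Fin n → ℕ)
    (h : μ i < μ j) : fstar μ = hecke i j (fstar (μ ∘ Equiv.swap i j)) := by
  rw [fstar_step hij _ (by simpa using h), comp_swap_swap]

lemma fstar_partition {n : ℕ} (μ : Fin n → ℕ) (h : IsPartition μ) : fstar μ = Estar μ :=
  reach_unique _ _ rfl _ _ (reach_fstar _) (Reach.base μ h)

lemma fstar_eq {n : ℕ} : ∀ (d : ℕ) (μ : Fin n → ℕ), ascN μ = d → ∀ (i j : Fin n),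
    (j : ℕ) = (i : ℕ) + 1 → μ i = μ j → hecke i j (fstar μ) = C tt * fstar μ := by
  intro d
  induction d using Nat.strong_induction_on with
  | _ d ih =>
  intro μ hd i j hij h
  have nij := ne_of_adj hij
  by_cases hp : IsPartition μ
  · rw [fstar_partition μ hp]
    exact hecke_Estar hij μ h
  obtain ⟨a, b, hab, hlt⟩ := exists_ascent μ hp
  have nab := ne_of_adj hab
  have e1 := ascN_swap' hab μ hlt
  have c1 : a ≠ i := by
    rintro rfl
    have : b = j := Fin.ext (by omega)
    subst this
    omega
  have c4 : b ≠ j := by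
    rintro rfl
    exact c1 (Fin.ext (by omega))
  rw [fstar_step' hab μ hlt]
  by_cases c2 : a = j
  · subst c2
    have nib : i ≠ b := by intro hh; rw [hh] at hij; omega
    have s1 : Equiv.swap a b i = i := Equiv.swap_apply_of_ne_of_ne nij nib
    have s2 : Equiv.swap i a b = b := Equiv.swap_apply_of_ne_of_ne nib.symm nab.symm
    have h2 : (μ ∘ Equiv.swap a b) i < (μ ∘ Equiv.swap a b) a := by simp [s1]; omega
    have e2 := ascN_swap' hij _ h2
    rw [fstar_step' hij _ h2, hecke_braid nij nab nib,
      ih _ (by omega) _ rfl a b hab (by simp [s1, s2, h]), hecke_smul nij, hecke_smul nab]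
  by_cases c3 : b = i
  · subst c3
    have naj : a ≠ j := c2
    have s1 : Equiv.swap a b j = j := Equiv.swap_apply_of_ne_of_ne naj.symm nij.symm
    have s2 : Equiv.swap b j a = a := Equiv.swap_apply_of_ne_of_ne nab naj
    have h2 : (μ ∘ Equiv.swap a b) b < (μ ∘ Equiv.swap a b) j := by simp [s1]; omega
    have e2 := ascN_swap' hij _ h2
    rw [fstar_step' hij _ h2, ← hecke_braid nab nij naj,
      ih _ (by omega) _ rfl a b hab (by simp [s1, s2, h]), hecke_smul nij, hecke_smul nab]
  · rw [hecke_comm nij nab c1.symm (Ne.symm c3) (Ne.symm c2) c4.symm,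
      ih _ (by omega) _ rfl i j hij (by
        simp only [Function.comp]
        rw [Equiv.swap_apply_of_ne_of_ne c1.symm (Ne.symm c3),
          Equiv.swap_apply_of_ne_of_ne (Ne.symm c2) c4.symm]
        exact h), hecke_smul nab]

lemma fhom_desc {n : ℕ} {i j : Fin n} (hij : (j : ℕ) = (i : ℕ) + 1) (μ : Fin n → ℕ)
    (h : μ j < μ i) : hecke i j (fhom μ) = fhom (μ ∘ Equiv.swap i j) := by
  unfold fhom
  rw [hecke_homogeneousComponent (ne_of_adj hij), fstar_step hij μ h, csize_swap]

lemma fhom_eq {n : ℕ} {i j : Fin n} (hij : (j : ℕ) = (i : ℕ) + 1) (μ : Fin n → ℕ)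
    (h : μ i = μ j) : hecke i j (fhom μ) = C tt * fhom μ := by
  unfold fhom
  rw [hecke_homogeneousComponent (ne_of_adj hij), fstar_eq _ μ rfl i j hij h,
    homogeneousComponent_C_mul]

lemma fhom_asc {n : ℕ} {i j : Fin n} (hij : (j : ℕ) = (i : ℕ) + 1) (μ : Fin n → ℕ)
    (h : μ i < μ j) : hecke i j (fhom μ) =
      C tt * fhom (μ ∘ Equiv.swap i j) - C (1 - tt) * fhom μ := by
  have h1 := fhom_desc hij (μ ∘ Equiv.swap i j) (by simpa using h)
  rw [comp_swap_swap] at h1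
  rw [← h1, hecke_quad (ne_of_adj hij)]

/-! ### Extended ASEP polynomials -/

/-- The factor `−t^{n−1} x_m`, or `1`. -/
def negFac {n : ℕ} (α : Fin n → ℤ) (m : Fin n) : MvPolynomial (Fin n) K :=
  if α m < 0 then C (-(tt ^ (n - 1))) * X m else 1

/-- The part of the denominator away from `i, j`. -/
def restProd {n : ℕ} (i j : Fin n) (α : Fin n → ℤ) : MvPolynomial (Fin n) K :=
  ∏ m ∈ (Finset.univ.erase i).erase j, negFac α m

lemma c_ne_zero (n : ℕ) : (-(tt ^ (n - 1)) : K) ≠ 0 :=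
  neg_ne_zero.mpr (pow_ne_zero _ tt_ne_zero)

lemma negFac_ne_zero {n : ℕ} (α : Fin n → ℤ) (m : Fin n) : negFac α m ≠ 0 := by
  unfold negFac
  split_ifs
  · exact mul_ne_zero (by rw [Ne, C_eq_zero]; exact c_ne_zero n) (X_ne_zero m)
  · exact one_ne_zero

lemma restProd_ne_zero {n : ℕ} (i j : Fin n) (α : Fin n → ℤ) : restProd i j α ≠ 0 :=
  Finset.prod_ne_zero_iff.mpr fun m _ => negFac_ne_zero α m

lemma restProd_congr {n : ℕ} {i j : Fin n} {α β : Fin n → ℤ}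
    (h : ∀ m, m ≠ i → m ≠ j → α m = β m) : restProd i j α = restProd i j β := by
  unfold restProd
  apply Finset.prod_congr rfl
  intro m hm
  simp only [Finset.mem_erase, Finset.mem_univ, and_true] at hm
  unfold negFac
  rw [h m hm.2 hm.1]

lemma swapVars_restProd {n : ℕ} (i j : Fin n) (α : Fin n → ℤ) :
    swapVars i j (restProd i j α) = restProd i j α := by
  unfold restProd swapVars
  rw [map_prod]
  apply Finset.prod_congr rfl
  intro m hm
  simp only [Finset.mem_erase, Finset.mem_univ, and_true] at hm
  unfold negFac
  split_ifs
  · rw [map_mul, rename_C, rename_X, Equiv.swap_apply_of_ne_of_ne hm.2 hm.1]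
  · exact map_one _

lemma fext_spec {n : ℕ}
    (hdvd : ∀ κ : Fin n → ℕ,
      (∏ j ∈ Finset.univ.filter (fun j : Fin n => 0 < κ j), X j) ∣ fhom (n := n) κ)
    (α : Fin n → ℤ) (i j : Fin n) (hij : i ≠ j) :
    fhom (absComp α) = negFac α i * negFac α j * restProd i j α * fext α := by
  have h : (∏ j ∈ Finset.univ.filter (fun j : Fin n => α j < 0),
      (C (-(tt ^ (n - 1))) * X j)) ∣ fhom (absComp α) := by
    rw [Finset.prod_mul_distrib, IsUnit.mul_left_dvd]
    · refine dvd_trans ?_ (hdvd (absComp α))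
      apply Finset.prod_dvd_prod_of_subset
      intro m hm
      exact Finset.mem_filter.mpr ⟨Finset.mem_univ _,
        Int.natAbs_pos.mpr (Finset.mem_filter.mp hm).2.ne⟩
    · rw [Finset.prod_const]
      exact ((isUnit_iff_ne_zero.mpr (c_ne_zero n)).map C).pow _
  have h1 := exactDiv_spec h
  have h2 : (∏ j ∈ Finset.univ.filter (fun j : Fin n => α j < 0),
      (C (-(tt ^ (n - 1))) * X j)) = negFac α i * negFac α j * restProd i j α := by
    rw [Finset.prod_filter, mul_assoc]
    unfold restProd
    rw [Finset.mul_prod_erase _ _ (by simp [hij.symm]), Finset.mul_prod_erase _ _ (by simp)]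
    rfl
  rw [h2] at h1
  unfold fext
  rw [h2]
  exact h1

lemma hecke_sym_mul {n : ℕ} {i j : Fin n} (hij : i ≠ j) (R f : MvPolynomial (Fin n) K)
    (hR : swapVars i j R = R) : hecke i j (R * f) = R * hecke i j f := by
  apply hecke_eq hij
  rw [swapVars_mul, hR]
  linear_combination R * hecke_spec i j f

lemma X_mul_hecke_right {n : ℕ} {i j : Fin n} (hij : i ≠ j) (f : MvPolynomial (Fin n) K) :
    X i * hecke i j f = hecke i j (X j * f) + C (1 - tt) * (X j * f) := by
  have : hecke i j (X j * f) = X i * hecke i j f - C (1 - tt) * (X j * f) := by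
    apply hecke_eq hij
    rw [swapVars_mul, swapVars_X, Equiv.swap_apply_right, C_sub, C_1]
    linear_combination X i * hecke_spec i j f
  rw [this]; ring

lemma X_mul_hecke_left {n : ℕ} {i j : Fin n} (hij : i ≠ j) (f : MvPolynomial (Fin n) K) :
    X j * hecke i j f = hecke i j (X i * f) - C (1 - tt) * (X j * f) := by
  have : hecke i j (X i * f) = X j * hecke i j f + C (1 - tt) * (X j * f) := by
    apply hecke_eq hij
    rw [swapVars_mul, swapVars_X, Equiv.swap_apply_left, C_sub, C_1]
    linear_combination X j * hecke_spec i j f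
  rw [this]; ring

lemma absComp_swap {n : ℕ} (i j : Fin n) (α : Fin n → ℤ) :
    absComp (swapEntriesZ i j α) = absComp α ∘ Equiv.swap i j := rfl

lemma absComp_neg {n : ℕ} (i j : Fin n) (α : Fin n → ℤ) :
    absComp (negPairZ i j α) = absComp α := by
  funext m
  simp only [absComp, negPairZ]
  split_ifs <;> simp

/-- Hecke action on extended ASEP polynomials. -/
theorem statement15 (n : ℕ)
    (hdvd : ∀ κ : Fin n → ℕ,
      (∏ j ∈ Finset.univ.filter (fun j : Fin n => 0 < κ j), X j) ∣ fhom (n := n) κ)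
    (α : Fin n → ℤ) (i j : Fin n) (hij : (j : ℕ) = (i : ℕ) + 1) :
    ((α i > α j ∧ α j ≥ 0) ∨ (-α i > -α j ∧ -α j > 0) →
      hecke i j (fext α) = fext (swapEntriesZ i j α)) ∧
    (α i = α j → hecke i j (fext α) = C tt * fext α) ∧
    ((α j > α i ∧ α i ≥ 0) ∨ (-α j > -α i ∧ -α i > 0) →
      hecke i j (fext α) = C tt * fext (swapEntriesZ i j α) - C (1 - tt) * fext α) ∧
    (α i > -α j ∧ -α j > 0 →
      hecke i j (fext α) = fext (swapEntriesZ i j α) + C (1 - tt) * fext (negPairZ i j α)) ∧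
    (α i = -α j ∧ 0 < α i → hecke i j (fext α) = fext (swapEntriesZ i j α)) ∧
    (-α j > α i ∧ 0 ≤ α i → hecke i j (fext α) = C tt * fext (swapEntriesZ i j α)) ∧
    (-α i > α j ∧ 0 ≤ α j →
      hecke i j (fext α) = fext (swapEntriesZ i j α) - C (1 - tt) * fext α) ∧
    (-α i = α j ∧ 0 < α j →
      hecke i j (fext α) = C tt * fext (swapEntriesZ i j α) - C (1 - tt) * fext α) ∧
    (α j > -α i ∧ -α i > 0 →
      hecke i j (fext α) =
        C tt * fext (swapEntriesZ i j α) - C (1 - tt) * (fext α + fext (negPairZ i j α))) := by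
  have hne := ne_of_adj hij
  have hR0 := restProd_ne_zero i j α
  have hRs := swapVars_restProd i j α
  have sF := fext_spec hdvd α i j hne
  have sF' := fext_spec hdvd (swapEntriesZ i j α) i j hne
  have sF0 := fext_spec hdvd (negPairZ i j α) i j hne
  rw [absComp_swap, ← restProd_congr (α := α) (fun m h1 h2 => by
    simp [swapEntriesZ, Equiv.swap_apply_of_ne_of_ne h1 h2])] at sF'
  rw [absComp_neg, ← restProd_congr (α := α) (fun m h1 h2 => by
    simp [negPairZ, h1, h2])] at sF0
  have wi : swapEntriesZ i j α i = α j := by simp [swapEntriesZ]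
  have wj : swapEntriesZ i j α j = α i := by simp [swapEntriesZ]
  have vi : negPairZ i j α i = -α i := by simp [negPairZ]
  have vj : negPairZ i j α j = -α j := by simp [negPairZ]
  have hd := fhom_desc hij (absComp α)
  have he := fhom_eq hij (absComp α)
  have ha := fhom_asc hij (absComp α)
  have hs := comp_swap_of_eq i j (absComp α)
  simp only [absComp] at hd he ha hs
  unfold negFac at sF sF' sF0
  rw [wi, wj] at sF'
  rw [vi, vj] at sF0
  set c : K := -(tt ^ (n - 1)) with hc
  have hc0 : (C c : MvPolynomial (Fin n) K) ≠ 0 := by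
    rw [Ne, C_eq_zero]; exact c_ne_zero n
  have hXi : (X i : MvPolynomial (Fin n) K) ≠ 0 := X_ne_zero i
  have hXj : (X j : MvPolynomial (Fin n) K) ≠ 0 := X_ne_zero j
  set R := restProd i j α
  set f := fext α
  set f' := fext (swapEntriesZ i j α)
  set f0 := fext (negPairZ i j α)
  set F := fhom (absComp α)
  set F' := fhom (absComp α ∘ Equiv.swap i j)
  -- symmetric situation
  have symm : (0 ≤ α i ∧ 0 ≤ α j) ∨ (α i < 0 ∧ α j < 0) → ∃ Q : MvPolynomial (Fin n) K,
      Q ≠ 0 ∧ F = Q * f ∧ F' = Q * f' ∧ hecke i j F = Q * hecke i j f := by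
    rintro (⟨h1, h2⟩ | ⟨h1, h2⟩)
    · rw [if_neg (by omega), if_neg (by omega), one_mul, one_mul] at sF sF'
      exact ⟨R, hR0, sF, sF', by rw [sF, hecke_sym_mul hne R f hRs]⟩
    · rw [if_pos h1, if_pos h2] at sF
      rw [if_pos h1, if_pos h2] at sF'
      refine ⟨C c * X i * (C c * X j) * R, by simp [hc0, hXi, hXj, hR0], sF, sF', ?_⟩
      rw [sF, hecke_sym_mul hne]
      simp only [swapVars_mul, swapVars_C, swapVars_X, Equiv.swap_apply_left,
        Equiv.swap_apply_right, hRs]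
      ring
  have hQs : swapVars i j (C c * R) = C c * R := by rw [swapVars_mul, swapVars_C, hRs]
  -- `α_i ≥ 0 > α_j`
  have right : 0 ≤ α i → α j < 0 → ∃ Q : MvPolynomial (Fin n) K,
      Q ≠ 0 ∧ F' = Q * f' ∧ (0 < α i → F = Q * f0) ∧
        Q * hecke i j f = hecke i j F + C (1 - tt) * F := by
    intro h1 h2
    rw [if_neg (by omega), if_pos h2] at sF
    rw [if_pos h2, if_neg (by omega)] at sF'
    refine ⟨C c * R * X i, by simp [hc0, hXi, hR0], by rw [sF']; ring, ?_, ?_⟩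
    · intro h3
      rw [if_pos (by omega), if_neg (by omega)] at sF0
      rw [sF0]; ring
    · have e : F = (C c * R) * (X j * f) := by rw [sF]; ring
      rw [e, hecke_sym_mul hne _ _ hQs]
      linear_combination (C c * R) * X_mul_hecke_right hne f
  -- `α_i < 0 ≤ α_j`
  have left : α i < 0 → 0 ≤ α j → ∃ Q : MvPolynomial (Fin n) K,
      Q ≠ 0 ∧ F' = Q * f' ∧ (0 < α j → F = Q * f0) ∧
        Q * hecke i j f = hecke i j F - C (1 - tt) * (Q * f) := by
    intro h1 h2
    rw [if_pos h1, if_neg (by omega)] at sF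
    rw [if_pos h1, if_neg (by omega)] at sF'
    refine ⟨C c * R * X j, by simp [hc0, hXj, hR0], by rw [sF']; ring, ?_, ?_⟩
    · intro h3
      rw [if_neg (by omega), if_pos (by omega)] at sF0
      rw [sF0]; ring
    · have e : F = (C c * R) * (X i * f) := by rw [sF]; ring
      rw [e, hecke_sym_mul hne _ _ hQs]
      linear_combination (C c * R) * X_mul_hecke_left hne f
  clear sF sF' sF0
  refine ⟨?_, ?_, ?_, ?_, ?_, ?_, ?_, ?_, ?_⟩
  · intro h
    obtain ⟨Q, hQ, e1, e2, e3⟩ := symm (by omega)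
    apply mul_left_cancel₀ hQ
    rw [← e3, hd (by omega), e2]
  · intro h
    obtain ⟨Q, hQ, e1, e2, e3⟩ := symm (by omega)
    apply mul_left_cancel₀ hQ
    rw [← e3, he (by omega), e1]
    ring
  · intro h
    obtain ⟨Q, hQ, e1, e2, e3⟩ := symm (by omega)
    apply mul_left_cancel₀ hQ
    rw [← e3, ha (by omega), e1, e2]
    ring
  · intro h
    obtain ⟨Q, hQ, e1, e2, e3⟩ := right (by omega) (by omega)
    apply mul_left_cancel₀ hQ
    rw [e3, hd (by omega), e1, e2 (by omega)]
    ring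
  · intro h
    obtain ⟨Q, hQ, e1, e2, e3⟩ := right (by omega) (by omega)
    have e4 : F' = F := congrArg fhom (hs (by omega))
    apply mul_left_cancel₀ hQ
    rw [e3, he (by omega), ← e1, e4, C_sub, C_1]
    ring
  · intro h
    obtain ⟨Q, hQ, e1, e2, e3⟩ := right (by omega) (by omega)
    apply mul_left_cancel₀ hQ
    rw [e3, ha (by omega), e1]
    ring
  · intro h
    obtain ⟨Q, hQ, e1, e2, e3⟩ := left (by omega) (by omega)
    apply mul_left_cancel₀ hQ
    rw [e3, hd (by omega), e1]
    ring
  · intro h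
    obtain ⟨Q, hQ, e1, e2, e3⟩ := left (by omega) (by omega)
    have e4 : F' = F := congrArg fhom (hs (by omega))
    apply mul_left_cancel₀ hQ
    rw [e3, he (by omega), ← e4, e1]
    ring
  · intro h
    obtain ⟨Q, hQ, e1, e2, e3⟩ := left (by omega) (by omega)
    apply mul_left_cancel₀ hQ
    rw [e3, ha (by omega), e1, e2 (by omega)]
    ring
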